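/- arXiv:1803.02448 — 2 statements merged into one kernel-verified Lean document; each statement's English description precedes it below -/
import Mathlib

section
/- Let Ω ⊆ ℝ² be open, let H ∈ C¹(ℝ^m,ℝ^m) with ∂_iH_j = ∂_jH_i, and let u = (u_1,…,u_m), u_i ∈ C³(Ω), be a stable solution of Δ_G u_i = H_i(u) in Ω. Then for all ζ_1,…,ζ_m ∈ C²(Ω) with compact support in Ω: Σ_i ∫_{Ω∩{|∇_G u_i|≠0}} [(XXu_i)² + (XYu_i)² + (YXu_i)² + (YYu_i)² − (X|∇_G u_i|)² − (Y|∇_G u_i|)²]·ζ_i² − 2Σ_i ∫_Ω [(Z(Yu_i))·(Xu_i) − (Z(Xu_i))·(Yu_i)]·ζ_i² + Σ_{i≠j} ∫_Ω ∂_jH_i(u)·[((Xu_i)(Xu_j) + (Yu_i)(Yu_j))·ζ_i² − |∇_G u_i|·|∇_G u_j|·ζ_i·ζ_j] ≤ Σ_i ∫_Ω |∇_G u_i|²·((Xζ_i)² + (Yζ_i)²). -/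
open MeasureTheory Real Filter

/-- Partial derivative in the `x`-variable. -/
noncomputable def pdx (u : ℝ × ℝ → ℝ) (p : ℝ × ℝ) : ℝ :=
  deriv (fun t => u (t, p.2)) p.1

/-- Partial derivative in the `y`-variable. -/
noncomputable def pdy (u : ℝ × ℝ → ℝ) (p : ℝ × ℝ) : ℝ :=
  deriv (fun t => u (p.1, t)) p.2

/-- The Grushin vector field `X u = ∂ₓ u`. -/
noncomputable def Xg (u : ℝ × ℝ → ℝ) (p : ℝ × ℝ) : ℝ := pdx u p

/-- The Grushin vector field `Y u = x·∂_y u`. -/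
noncomputable def Yg (u : ℝ × ℝ → ℝ) (p : ℝ × ℝ) : ℝ := p.1 * pdy u p

/-- The commutator field `Z u = ∂_y u`. -/
noncomputable def Zg (u : ℝ × ℝ → ℝ) (p : ℝ × ℝ) : ℝ := pdy u p

/-- The Grushin Laplacian `Δ_G u = X(Xu) + Y(Yu)`. -/
noncomputable def deltaG (u : ℝ × ℝ → ℝ) (p : ℝ × ℝ) : ℝ := Xg (Xg u) p + Yg (Yg u) p

/-- The norm of the Grushin gradient, `|∇_G u| = √((Xu)² + (Yu)²)`. -/
noncomputable def normG (u : ℝ × ℝ → ℝ) (p : ℝ × ℝ) : ℝ :=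
  Real.sqrt ((Xg u p) ^ 2 + (Yg u p) ^ 2)

/-- The `j`-th partial derivative of a function `H : ℝ^m → ℝ`. -/
noncomputable def pdH {m : ℕ} (H : (Fin m → ℝ) → ℝ) (j : Fin m) (v : Fin m → ℝ) : ℝ :=
  fderiv ℝ H v (Pi.single j 1)

/-- Intrinsic curvature `𝒜` of the level sets. -/
noncomputable def curvA (u : ℝ × ℝ → ℝ) (p : ℝ × ℝ) : ℝ :=
  ((normG u p) ^ 3)⁻¹ *
    (Xg (Xg u) p * (Yg u p) ^ 2 - Xg (Yg u) p * Xg u p * Yg u p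
      - Yg (Xg u) p * Xg u p * Yg u p + Yg (Yg u) p * (Xg u p) ^ 2)

/-- Intrinsic tangential quantity `ℬ` of the level sets. -/
noncomputable def curvB (u : ℝ × ℝ → ℝ) (p : ℝ × ℝ) : ℝ :=
  ((normG u p) ^ 3)⁻¹ *
    (Xg (Xg u) p * Xg u p * Yg u p - Xg (Yg u) p * (Xg u p) ^ 2
      + Yg (Xg u) p * (Yg u p) ^ 2 - Yg (Yg u) p * Xg u p * Yg u p)

/-- The Grushin ball `B_R = {(x,y) : x⁴ + y² < R⁴}`. -/
def ballG (R : ℝ) : Set (ℝ × ℝ) := {p : ℝ × ℝ | p.1 ^ 4 + p.2 ^ 2 < R ^ 4}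

/-- The Grushin norm `‖(x,y)‖_G = (x⁴+y²)^(1/4)`. -/
noncomputable def grushinNorm (p : ℝ × ℝ) : ℝ := (p.1 ^ 4 + p.2 ^ 2) ^ ((1 : ℝ) / 4)

theorem pdx_eq_fderiv {f : ℝ × ℝ → ℝ} {p : ℝ × ℝ} (h : DifferentiableAt ℝ f p) :
    pdx f p = fderiv ℝ f p (1, 0) := by
  have h1 : HasDerivAt (fun t : ℝ => (t, p.2)) ((1 : ℝ), (0 : ℝ)) p.1 :=
    (hasDerivAt_id p.1).prodMk (hasDerivAt_const p.1 p.2)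
  exact (HasFDerivAt.comp_hasDerivAt (f := fun t : ℝ => (t, p.2)) p.1 h.hasFDerivAt h1).deriv

theorem pdy_eq_fderiv {f : ℝ × ℝ → ℝ} {p : ℝ × ℝ} (h : DifferentiableAt ℝ f p) :
    pdy f p = fderiv ℝ f p (0, 1) := by
  have h1 : HasDerivAt (fun t : ℝ => (p.1, t)) ((0 : ℝ), (1 : ℝ)) p.2 :=
    (hasDerivAt_const p.2 p.1).prodMk (hasDerivAt_id p.2)
  exact (HasFDerivAt.comp_hasDerivAt (f := fun t : ℝ => (p.1, t)) p.2 h.hasFDerivAt h1).deriv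

theorem pdx_add {f g : ℝ × ℝ → ℝ} {p : ℝ × ℝ} (hf : DifferentiableAt ℝ f p)
    (hg : DifferentiableAt ℝ g p) : pdx (fun q => f q + g q) p = pdx f p + pdx g p := by
  rw [pdx_eq_fderiv hf, pdx_eq_fderiv hg, pdx_eq_fderiv (hf.fun_add hg), fderiv_fun_add hf hg]
  rfl

theorem pdy_add {f g : ℝ × ℝ → ℝ} {p : ℝ × ℝ} (hf : DifferentiableAt ℝ f p)
    (hg : DifferentiableAt ℝ g p) : pdy (fun q => f q + g q) p = pdy f p + pdy g p := by
  rw [pdy_eq_fderiv hf, pdy_eq_fderiv hg, pdy_eq_fderiv (hf.fun_add hg), fderiv_fun_add hf hg]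
  rfl

theorem pdx_mul {f g : ℝ × ℝ → ℝ} {p : ℝ × ℝ} (hf : DifferentiableAt ℝ f p)
    (hg : DifferentiableAt ℝ g p) :
    pdx (fun q => f q * g q) p = pdx f p * g p + f p * pdx g p := by
  rw [pdx_eq_fderiv hf, pdx_eq_fderiv hg, pdx_eq_fderiv (hf.fun_mul hg), fderiv_fun_mul hf hg]
  simp
  ring

theorem pdy_mul {f g : ℝ × ℝ → ℝ} {p : ℝ × ℝ} (hf : DifferentiableAt ℝ f p)
    (hg : DifferentiableAt ℝ g p) :
    pdy (fun q => f q * g q) p = pdy f p * g p + f p * pdy g p := by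
  rw [pdy_eq_fderiv hf, pdy_eq_fderiv hg, pdy_eq_fderiv (hf.fun_mul hg), fderiv_fun_mul hf hg]
  simp
  ring

theorem pdx_fst (p : ℝ × ℝ) : pdx Prod.fst p = 1 := by
  simp [pdx]

theorem pdy_fst (p : ℝ × ℝ) : pdy Prod.fst p = 0 := by
  simp [pdy]

theorem pdx_congr {f g : ℝ × ℝ → ℝ} {s : Set (ℝ × ℝ)} (hs : IsOpen s) (h : Set.EqOn f g s)
    {p : ℝ × ℝ} (hp : p ∈ s) : pdx f p = pdx g p := by
  refine Filter.EventuallyEq.deriv_eq ?_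
  have hc : ContinuousAt (fun t : ℝ => (t, p.2)) p.1 := by fun_prop
  filter_upwards [hc.preimage_mem_nhds (hs.mem_nhds hp)] with t ht using h ht

theorem pdy_congr {f g : ℝ × ℝ → ℝ} {s : Set (ℝ × ℝ)} (hs : IsOpen s) (h : Set.EqOn f g s)
    {p : ℝ × ℝ} (hp : p ∈ s) : pdy f p = pdy g p := by
  refine Filter.EventuallyEq.deriv_eq ?_
  have hc : ContinuousAt (fun t : ℝ => (p.1, t)) p.2 := by fun_prop
  filter_upwards [hc.preimage_mem_nhds (hs.mem_nhds hp)] with t ht using h ht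

theorem pdx_eq_zero_of_notMem_tsupport {f : ℝ × ℝ → ℝ} {p : ℝ × ℝ} (hp : p ∉ tsupport f) :
    pdx f p = 0 := by
  rw [pdx_congr (g := fun _ => 0) (isClosed_tsupport f).isOpen_compl
    (fun q hq => image_eq_zero_of_notMem_tsupport hq) hp]
  simp [pdx]

theorem pdy_eq_zero_of_notMem_tsupport {f : ℝ × ℝ → ℝ} {p : ℝ × ℝ} (hp : p ∉ tsupport f) :
    pdy f p = 0 := by
  rw [pdy_congr (g := fun _ => 0) (isClosed_tsupport f).isOpen_compl
    (fun q hq => image_eq_zero_of_notMem_tsupport hq) hp]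
  simp [pdy]

theorem Yg_eq_zero_of_notMem_tsupport {f : ℝ × ℝ → ℝ} {p : ℝ × ℝ} (hp : p ∉ tsupport f) :
    Yg f p = 0 := by
  rw [Yg, pdy_eq_zero_of_notMem_tsupport hp, mul_zero]

theorem ContDiffOn.pdx {f : ℝ × ℝ → ℝ} {s : Set (ℝ × ℝ)} (hs : IsOpen s) {m n : WithTop ℕ∞}
    (hf : ContDiffOn ℝ n f s) (hmn : m + 1 ≤ n) : ContDiffOn ℝ m (pdx f) s := by
  have h := (hf.fderiv_of_isOpen hs hmn).clm_apply
    (contDiffOn_const (c := ((1 : ℝ), (0 : ℝ))))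
  refine h.congr fun p hp => pdx_eq_fderiv ?_
  exact (hf.contDiffAt (hs.mem_nhds hp)).differentiableAt
    (fun h0 => by simp [h0] at hmn)

theorem ContDiffOn.pdy {f : ℝ × ℝ → ℝ} {s : Set (ℝ × ℝ)} (hs : IsOpen s) {m n : WithTop ℕ∞}
    (hf : ContDiffOn ℝ n f s) (hmn : m + 1 ≤ n) : ContDiffOn ℝ m (pdy f) s := by
  have h := (hf.fderiv_of_isOpen hs hmn).clm_apply
    (contDiffOn_const (c := ((0 : ℝ), (1 : ℝ))))
  refine h.congr fun p hp => pdy_eq_fderiv ?_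
  exact (hf.contDiffAt (hs.mem_nhds hp)).differentiableAt
    (fun h0 => by simp [h0] at hmn)

theorem ContDiffOn.Xg {f : ℝ × ℝ → ℝ} {s : Set (ℝ × ℝ)} (hs : IsOpen s) {m n : WithTop ℕ∞}
    (hf : ContDiffOn ℝ n f s) (hmn : m + 1 ≤ n) : ContDiffOn ℝ m (Xg f) s :=
  ContDiffOn.pdx hs hf hmn

theorem ContDiffOn.Yg {f : ℝ × ℝ → ℝ} {s : Set (ℝ × ℝ)} (hs : IsOpen s) {m n : WithTop ℕ∞}
    (hf : ContDiffOn ℝ n f s) (hmn : m + 1 ≤ n) : ContDiffOn ℝ m (Yg f) s :=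
  contDiffOn_fst.mul (ContDiffOn.pdy hs hf hmn)

theorem pdx_pdy_comm {f : ℝ × ℝ → ℝ} {s : Set (ℝ × ℝ)} (hs : IsOpen s)
    (hf : ContDiffOn ℝ 2 f s) {p : ℝ × ℝ} (hp : p ∈ s) : pdx (pdy f) p = pdy (pdx f) p := by
  have hd : ∀ q ∈ s, DifferentiableAt ℝ f q := fun q hq =>
    (hf.contDiffAt (hs.mem_nhds hq)).differentiableAt (by norm_num)
  have hd1 : DifferentiableAt ℝ (fderiv ℝ f) p :=
    ((hf.fderiv_of_isOpen (m := 1) hs (by norm_num)).contDiffAt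
      (hs.mem_nhds hp)).differentiableAt (by norm_num)
  have hsym : IsSymmSndFDerivAt ℝ f p :=
    (hf.contDiffAt (hs.mem_nhds hp)).isSymmSndFDerivAt (by simp)
  rw [pdx_congr (g := fun q => fderiv ℝ f q (0, 1)) hs (fun q hq => pdy_eq_fderiv (hd q hq)) hp,
    pdy_congr (g := fun q => fderiv ℝ f q (1, 0)) hs (fun q hq => pdx_eq_fderiv (hd q hq)) hp,
    pdx_eq_fderiv (hd1.clm_apply (differentiableAt_const _)),
    pdy_eq_fderiv (hd1.clm_apply (differentiableAt_const _)),
    fderiv_clm_apply hd1 (differentiableAt_const _),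
    fderiv_clm_apply hd1 (differentiableAt_const _)]
  simpa using hsym.eq (1, 0) (0, 1)

theorem contDiff_mul_of_tsupport_subset {f φ : ℝ × ℝ → ℝ} {s : Set (ℝ × ℝ)} (hs : IsOpen s)
    {n : WithTop ℕ∞} (hφ : ContDiff ℝ n φ) (hφs : tsupport φ ⊆ s) (hf : ContDiffOn ℝ n f s) :
    ContDiff ℝ n (fun p => φ p * f p) := by
  rw [contDiff_iff_contDiffAt]
  intro p
  by_cases hp : p ∈ s
  · exact hφ.contDiffAt.mul (hf.contDiffAt (hs.mem_nhds hp))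
  · refine (contDiffAt_const (c := (0 : ℝ))).congr_of_eventuallyEq ?_
    filter_upwards [(isClosed_tsupport φ).isOpen_compl.mem_nhds
      (fun h => hp (hφs h) : p ∈ (tsupport φ)ᶜ)] with q hq
    rw [image_eq_zero_of_notMem_tsupport hq, zero_mul]

theorem ContinuousOn.integrableOn_of_eq_zero_off_compact {f : ℝ × ℝ → ℝ} {s K : Set (ℝ × ℝ)}
    (hs : IsOpen s) (hf : ContinuousOn f s) (hK : IsCompact K) (hKs : K ⊆ s)
    (h0 : ∀ p ∉ K, f p = 0) : IntegrableOn f s :=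
  ((hf.mono hKs).integrableOn_compact hK).of_forall_sdiff_eq_zero hs.measurableSet
    fun p hp => h0 p hp.2

theorem continuous_pdx {f : ℝ × ℝ → ℝ} (hf : ContDiff ℝ 1 f) : Continuous (pdx f) :=
  continuousOn_univ.1
    (ContDiffOn.pdx (m := 0) isOpen_univ hf.contDiffOn (by simp)).continuousOn

theorem continuous_pdy {f : ℝ × ℝ → ℝ} (hf : ContDiff ℝ 1 f) : Continuous (pdy f) :=
  continuousOn_univ.1
    (ContDiffOn.pdy (m := 0) isOpen_univ hf.contDiffOn (by simp)).continuousOn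

theorem integral_pdx_eq_zero {f : ℝ × ℝ → ℝ} (hf : ContDiff ℝ 1 f) (hc : HasCompactSupport f) :
    ∫ p, pdx f p = 0 := by
  have hc' : HasCompactSupport (pdx f) :=
    HasCompactSupport.intro hc fun p hp => pdx_eq_zero_of_notMem_tsupport hp
  rw [Measure.volume_eq_prod, integral_prod_symm _
    ((continuous_pdx hf).integrable_of_hasCompactSupport hc')]
  refine integral_eq_zero_of_ae (Eventually.of_forall fun y => ?_)
  have he : Topology.IsClosedEmbedding fun t : ℝ => (t, y) :=
    Topology.IsClosedEmbedding.of_continuous_injective_isClosedMap (by fun_prop)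
      (fun a b h => congrArg Prod.fst h) (isClosedMap_prodMk_right y)
  refine integral_eq_zero_of_hasDerivAt_of_integrable (f := fun t => f (t, y)) (fun t => ?_)
    (((continuous_pdx hf).comp he.continuous).integrable_of_hasCompactSupport
      (hc'.comp_isClosedEmbedding he))
    ((hf.continuous.comp he.continuous).integrable_of_hasCompactSupport
      (hc.comp_isClosedEmbedding he))
  have hd : Differentiable ℝ f := hf.differentiable (by norm_num)
  have : DifferentiableAt ℝ (fun t => f (t, y)) t := by fun_prop
  exact this.hasDerivAt

theorem integral_pdy_eq_zero {f : ℝ × ℝ → ℝ} (hf : ContDiff ℝ 1 f) (hc : HasCompactSupport f) :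
    ∫ p, pdy f p = 0 := by
  have hc' : HasCompactSupport (pdy f) :=
    HasCompactSupport.intro hc fun p hp => pdy_eq_zero_of_notMem_tsupport hp
  rw [Measure.volume_eq_prod, integral_prod _
    ((continuous_pdy hf).integrable_of_hasCompactSupport hc')]
  refine integral_eq_zero_of_ae (Eventually.of_forall fun x => ?_)
  have he : Topology.IsClosedEmbedding fun t : ℝ => (x, t) :=
    Topology.IsClosedEmbedding.of_continuous_injective_isClosedMap (by fun_prop)
      (fun a b h => congrArg Prod.snd h) (isClosedMap_prodMk_left x)
  refine integral_eq_zero_of_hasDerivAt_of_integrable (f := fun t => f (x, t)) (fun t => ?_)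
    (((continuous_pdy hf).comp he.continuous).integrable_of_hasCompactSupport
      (hc'.comp_isClosedEmbedding he))
    ((hf.continuous.comp he.continuous).integrable_of_hasCompactSupport
      (hc.comp_isClosedEmbedding he))
  have hd : Differentiable ℝ f := hf.differentiable (by norm_num)
  have : DifferentiableAt ℝ (fun t => f (x, t)) t := by fun_prop
  exact this.hasDerivAt

theorem setIntegral_Xg_eq_zero {f : ℝ × ℝ → ℝ} {s : Set (ℝ × ℝ)} (hf : ContDiff ℝ 1 f)
    (hc : HasCompactSupport f) (hs : tsupport f ⊆ s) : ∫ p in s, Xg f p = 0 := by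
  rw [setIntegral_eq_integral_of_forall_compl_eq_zero (f := Xg f) fun p hp =>
    pdx_eq_zero_of_notMem_tsupport fun h => hp (hs h)]
  exact integral_pdx_eq_zero hf hc

theorem setIntegral_Yg_eq_zero {f : ℝ × ℝ → ℝ} {s : Set (ℝ × ℝ)} (hf : ContDiff ℝ 1 f)
    (hc : HasCompactSupport f) (hs : tsupport f ⊆ s) : ∫ p in s, Yg f p = 0 := by
  have h : ∀ p, Yg f p = pdy (fun q => q.1 * f q) p := fun p => by
    rw [pdy_mul differentiableAt_fst ((hf.differentiable (by norm_num)) p)]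
    simp [pdy_fst, Yg]
  rw [setIntegral_eq_integral_of_forall_compl_eq_zero fun p hp =>
    Yg_eq_zero_of_notMem_tsupport fun h => hp (hs h)]
  simp_rw [h]
  exact integral_pdy_eq_zero (contDiff_fst.mul hf) hc.mul_left

theorem tendsto_setIntegral_mul_sqrt_mul_sqrt {k A B : ℝ × ℝ → ℝ} {s K : Set (ℝ × ℝ)}
    (hs : IsOpen s) (hk : ContinuousOn k s) (hA : ContinuousOn A s) (hB : ContinuousOn B s)
    (hK : IsCompact K) (hKs : K ⊆ s) (h0 : ∀ p ∉ K, k p = 0) :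
    Tendsto (fun n : ℕ => ∫ p in s, k p *
      (√(A p + 1 / ((n : ℝ) + 1)) * √(B p + 1 / ((n : ℝ) + 1)))) atTop
      (nhds (∫ p in s, k p * (√(A p) * √(B p)))) := by
  have hδ : ∀ n : ℕ, 1 / ((n : ℝ) + 1) ≤ 1 := fun n => by
    rw [div_le_one (by positivity)]
    have : (0 : ℝ) ≤ n := by positivity
    linarith
  refine tendsto_integral_of_dominated_convergence
    (fun p => |k p| * (√(A p + 1) * √(B p + 1))) (fun n => ?_) ?_ (fun n => ?_) ?_
  · refine ContinuousOn.aestronglyMeasurable ?_ hs.measurableSet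
    fun_prop
  · refine ContinuousOn.integrableOn_of_eq_zero_off_compact hs ?_ hK hKs
      fun p hp => by simp [h0 p hp]
    fun_prop
  · refine Eventually.of_forall fun p => ?_
    rw [norm_mul, Real.norm_eq_abs, Real.norm_of_nonneg (by positivity)]
    have := hδ n
    gcongr
  · refine Eventually.of_forall fun p => ?_
    have ht : Tendsto (fun n : ℕ => 1 / ((n : ℝ) + 1)) atTop (nhds 0) :=
      tendsto_one_div_add_atTop_nhds_zero_nat
    have h1 : ∀ a : ℝ, Tendsto (fun n : ℕ => √(a + 1 / ((n : ℝ) + 1))) atTop (nhds √a) := by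
      intro a
      have := (ht.const_add a).sqrt
      rwa [add_zero] at this
    exact ((h1 _).mul (h1 _)).const_mul _

theorem pdx_fst_mul {f : ℝ × ℝ → ℝ} {p : ℝ × ℝ} (hf : DifferentiableAt ℝ f p) :
    pdx (fun q => q.1 * f q) p = f p + p.1 * pdx f p := by
  rw [pdx_mul differentiableAt_fst hf]
  simp [pdx_fst]

theorem pdy_fst_mul {f : ℝ × ℝ → ℝ} {p : ℝ × ℝ} (hf : DifferentiableAt ℝ f p) :
    pdy (fun q => q.1 * f q) p = p.1 * pdy f p := by
  rw [pdy_mul differentiableAt_fst hf]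
  simp [pdy_fst]

theorem Xg_mul {f g : ℝ × ℝ → ℝ} {p : ℝ × ℝ} (hf : DifferentiableAt ℝ f p)
    (hg : DifferentiableAt ℝ g p) :
    Xg (fun q => f q * g q) p = Xg f p * g p + f p * Xg g p :=
  pdx_mul hf hg

theorem Yg_mul {f g : ℝ × ℝ → ℝ} {p : ℝ × ℝ} (hf : DifferentiableAt ℝ f p)
    (hg : DifferentiableAt ℝ g p) :
    Yg (fun q => f q * g q) p = Yg f p * g p + f p * Yg g p := by
  simp only [Yg, pdy_mul hf hg]
  ring

theorem Xg_add {f g : ℝ × ℝ → ℝ} {p : ℝ × ℝ} (hf : DifferentiableAt ℝ f p)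
    (hg : DifferentiableAt ℝ g p) : Xg (fun q => f q + g q) p = Xg f p + Xg g p :=
  pdx_add hf hg

theorem Yg_add {f g : ℝ × ℝ → ℝ} {p : ℝ × ℝ} (hf : DifferentiableAt ℝ f p)
    (hg : DifferentiableAt ℝ g p) : Yg (fun q => f q + g q) p = Yg f p + Yg g p := by
  simp only [Yg, pdy_add hf hg]
  ring

theorem Xg_sqrt_sq_add_sq {f g : ℝ × ℝ → ℝ} {p : ℝ × ℝ} {δ : ℝ} (hf : DifferentiableAt ℝ f p)
    (hg : DifferentiableAt ℝ g p) (h : f p ^ 2 + g p ^ 2 + δ ≠ 0) :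
    Xg (fun q => √(f q ^ 2 + g q ^ 2 + δ)) p =
      (f p * Xg f p + g p * Xg g p) / √(f p ^ 2 + g p ^ 2 + δ) := by
  have hf' : HasDerivAt (fun t => f (t, p.2)) (pdx f p) p.1 := by
    have : DifferentiableAt ℝ (fun t : ℝ => f (t, p.2)) p.1 :=
      DifferentiableAt.comp (f := fun t : ℝ => (t, p.2)) p.1 hf (by fun_prop)
    exact this.hasDerivAt
  have hg' : HasDerivAt (fun t => g (t, p.2)) (pdx g p) p.1 := by
    have : DifferentiableAt ℝ (fun t : ℝ => g (t, p.2)) p.1 :=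
      DifferentiableAt.comp (f := fun t : ℝ => (t, p.2)) p.1 hg (by fun_prop)
    exact this.hasDerivAt
  have := (((hf'.fun_pow 2).fun_add (hg'.fun_pow 2)).add_const δ).sqrt h
  rw [Xg, pdx, this.deriv]
  simp only [Xg]
  push_cast
  rw [show 2 * f (p.1, p.2) ^ (2 - 1) * pdx f p + 2 * g (p.1, p.2) ^ (2 - 1) * pdx g p =
    2 * (f p * pdx f p + g p * pdx g p) by simp; ring, mul_div_mul_left _ _ two_ne_zero]

theorem Yg_sqrt_sq_add_sq {f g : ℝ × ℝ → ℝ} {p : ℝ × ℝ} {δ : ℝ} (hf : DifferentiableAt ℝ f p)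
    (hg : DifferentiableAt ℝ g p) (h : f p ^ 2 + g p ^ 2 + δ ≠ 0) :
    Yg (fun q => √(f q ^ 2 + g q ^ 2 + δ)) p =
      (f p * Yg f p + g p * Yg g p) / √(f p ^ 2 + g p ^ 2 + δ) := by
  have hf' : HasDerivAt (fun t => f (p.1, t)) (pdy f p) p.2 := by
    have : DifferentiableAt ℝ (fun t : ℝ => f (p.1, t)) p.2 :=
      DifferentiableAt.comp (f := fun t : ℝ => (p.1, t)) p.2 hf (by fun_prop)
    exact this.hasDerivAt
  have hg' : HasDerivAt (fun t => g (p.1, t)) (pdy g p) p.2 := by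
    have : DifferentiableAt ℝ (fun t : ℝ => g (p.1, t)) p.2 :=
      DifferentiableAt.comp (f := fun t : ℝ => (p.1, t)) p.2 hg (by fun_prop)
    exact this.hasDerivAt
  have := (((hf'.fun_pow 2).fun_add (hg'.fun_pow 2)).add_const δ).sqrt h
  rw [Yg, pdy, this.deriv]
  simp only [Yg]
  push_cast
  rw [show 2 * f (p.1, p.2) ^ (2 - 1) * pdy f p + 2 * g (p.1, p.2) ^ (2 - 1) * pdy g p =
    2 * (f p * pdy f p + g p * pdy g p) by simp; ring, mul_div_mul_left _ _ two_ne_zero]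
  ring

theorem ContDiffOn.differentiableAt_of_isOpen {f : ℝ × ℝ → ℝ} {s : Set (ℝ × ℝ)} (hs : IsOpen s)
    (hf : ContDiffOn ℝ 1 f s) {p : ℝ × ℝ} (hp : p ∈ s) : DifferentiableAt ℝ f p :=
  (hf.contDiffAt (hs.mem_nhds hp)).differentiableAt (by norm_num)

theorem eqOn_deltaG {u : ℝ × ℝ → ℝ} {s : Set (ℝ × ℝ)} (hs : IsOpen s)
    (hu : ContDiffOn ℝ 2 u s) :
    Set.EqOn (deltaG u) (fun q => pdx (pdx u) q + q.1 * (q.1 * pdy (pdy u) q)) s := by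
  intro q hq
  have hQ : ContDiffOn ℝ 1 (pdy u) s := ContDiffOn.pdy hs hu (by norm_num)
  change pdx (pdx u) q + q.1 * pdy (fun r => r.1 * pdy u r) q = _
  rw [pdy_fst_mul (hQ.differentiableAt_of_isOpen hs hq)]

theorem deltaG_Xg {u : ℝ × ℝ → ℝ} {s : Set (ℝ × ℝ)} (hs : IsOpen s) (hu : ContDiffOn ℝ 3 u s)
    {p : ℝ × ℝ} (hp : p ∈ s) : deltaG (Xg u) p = Xg (deltaG u) p - 2 * Zg (Yg u) p := by
  have hu2 : ContDiffOn ℝ 2 u s := hu.of_le (by norm_num)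
  have hP : ContDiffOn ℝ 2 (pdx u) s := ContDiffOn.pdx hs hu (by norm_num)
  have hQ : ContDiffOn ℝ 2 (pdy u) s := ContDiffOn.pdy hs hu (by norm_num)
  have hPx : ContDiffOn ℝ 1 (pdx (pdx u)) s := ContDiffOn.pdx hs hP (by norm_num)
  have hPy : ContDiffOn ℝ 1 (pdy (pdx u)) s := ContDiffOn.pdy hs hP (by norm_num)
  have hQy : ContDiffOn ℝ 1 (pdy (pdy u)) s := ContDiffOn.pdy hs hQ (by norm_num)
  have dQ := (hQ.of_le (by norm_num)).differentiableAt_of_isOpen hs hp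
  have dPx := hPx.differentiableAt_of_isOpen hs hp
  have dPy := hPy.differentiableAt_of_isOpen hs hp
  have dQy := hQy.differentiableAt_of_isOpen hs hp
  have hZ : Zg (Yg u) p = p.1 * pdy (pdy u) p := pdy_fst_mul dQ
  have h1 : deltaG (Xg u) p =
      pdx (pdx (pdx u)) p + p.1 * pdy (fun q => q.1 * pdy (pdx u) q) p := rfl
  rw [hZ, h1, pdy_fst_mul dPy, Xg, pdx_congr hs (eqOn_deltaG hs hu2) hp,
    pdx_add dPx (by fun_prop), pdx_fst_mul (by fun_prop), pdx_fst_mul dQy,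
    pdx_pdy_comm hs hQ hp, pdy_congr hs (fun q hq => pdx_pdy_comm hs hu2 hq) hp]
  ring

theorem deltaG_Yg {u : ℝ × ℝ → ℝ} {s : Set (ℝ × ℝ)} (hs : IsOpen s) (hu : ContDiffOn ℝ 3 u s)
    {p : ℝ × ℝ} (hp : p ∈ s) : deltaG (Yg u) p = Yg (deltaG u) p + 2 * Zg (Xg u) p := by
  have hu2 : ContDiffOn ℝ 2 u s := hu.of_le (by norm_num)
  have hP : ContDiffOn ℝ 2 (pdx u) s := ContDiffOn.pdx hs hu (by norm_num)
  have hQ : ContDiffOn ℝ 2 (pdy u) s := ContDiffOn.pdy hs hu (by norm_num)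
  have hPx : ContDiffOn ℝ 1 (pdx (pdx u)) s := ContDiffOn.pdx hs hP (by norm_num)
  have hQx : ContDiffOn ℝ 1 (pdx (pdy u)) s := ContDiffOn.pdx hs hQ (by norm_num)
  have hQy : ContDiffOn ℝ 1 (pdy (pdy u)) s := ContDiffOn.pdy hs hQ (by norm_num)
  have hQ1 : ContDiffOn ℝ 1 (pdy u) s := hQ.of_le (by norm_num)
  have dQ := hQ1.differentiableAt_of_isOpen hs hp
  have dPx := hPx.differentiableAt_of_isOpen hs hp
  have dQx := hQx.differentiableAt_of_isOpen hs hp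
  have dQy := hQy.differentiableAt_of_isOpen hs hp
  have hY2 : ContDiffOn ℝ 2 (Yg u) s := ContDiffOn.Yg hs hu (by norm_num)
  have hx : pdx (pdx (Yg u)) p = 2 * pdx (pdy u) p + p.1 * pdx (pdx (pdy u)) p := by
    rw [pdx_congr (f := pdx (Yg u)) (g := fun q => pdy u q + q.1 * pdx (pdy u) q) hs
      (fun q hq => pdx_fst_mul (hQ1.differentiableAt_of_isOpen hs hq)) hp,
      pdx_add dQ (by fun_prop), pdx_fst_mul dQx]
    ring
  have hy : pdy (pdy (Yg u)) p = p.1 * pdy (pdy (pdy u)) p := by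
    rw [pdy_congr (f := pdy (Yg u)) (g := fun q => q.1 * pdy (pdy u) q) hs
      (fun q hq => pdy_fst_mul (hQ1.differentiableAt_of_isOpen hs hq)) hp, pdy_fst_mul dQy]
  rw [eqOn_deltaG hs hY2 hp]
  simp only [hx, hy]
  rw [Yg, pdy_congr hs (eqOn_deltaG hs hu2) hp, pdy_add dPx (by fun_prop),
    pdy_fst_mul (by fun_prop), pdy_fst_mul dQy, ← pdx_pdy_comm hs hP hp,
    ← pdx_congr hs (fun q hq => pdx_pdy_comm hs hu2 hq) hp, pdx_pdy_comm hs hu2 hp]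
  simp only [Zg, show Xg u = pdx u from rfl]
  ring

/-- The squared Grushin Hessian of `u` minus `|∇_G √(|∇_G u|² + δ)|²`. -/
noncomputable def regularizedHessianDefect (δ : ℝ) (u : ℝ × ℝ → ℝ) (p : ℝ × ℝ) : ℝ :=
  (Xg (Xg u) p) ^ 2 + (Xg (Yg u) p) ^ 2 + (Yg (Xg u) p) ^ 2 + (Yg (Yg u) p) ^ 2
    - ((Xg u p * Xg (Xg u) p + Yg u p * Xg (Yg u) p) ^ 2
      + (Xg u p * Yg (Xg u) p + Yg u p * Yg (Yg u) p) ^ 2) / ((Xg u p) ^ 2 + (Yg u p) ^ 2 + δ)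

theorem regularizedHessianDefect_nonneg {δ : ℝ} (hδ : 0 ≤ δ) (u : ℝ × ℝ → ℝ) (p : ℝ × ℝ) :
    0 ≤ regularizedHessianDefect δ u p := by
  rw [regularizedHessianDefect, sub_nonneg]
  refine div_le_of_le_mul₀ (by positivity) (by positivity) ?_
  nlinarith [sq_nonneg (Xg u p * Xg (Yg u) p - Yg u p * Xg (Xg u) p),
    sq_nonneg (Xg u p * Yg (Yg u) p - Yg u p * Yg (Xg u) p),
    mul_nonneg hδ (sq_nonneg (Xg (Xg u) p)), mul_nonneg hδ (sq_nonneg (Xg (Yg u) p)),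
    mul_nonneg hδ (sq_nonneg (Yg (Xg u) p)), mul_nonneg hδ (sq_nonneg (Yg (Yg u) p))]

theorem regularizedHessianDefect_zero_le {δ : ℝ} (hδ : 0 ≤ δ) {u : ℝ × ℝ → ℝ} {p : ℝ × ℝ}
    (h : 0 < (Xg u p) ^ 2 + (Yg u p) ^ 2) :
    regularizedHessianDefect 0 u p ≤ regularizedHessianDefect δ u p := by
  simp only [regularizedHessianDefect]
  gcongr

theorem regularizedHessianDefect_zero_eq {u : ℝ × ℝ → ℝ} {p : ℝ × ℝ}
    (ha : DifferentiableAt ℝ (Xg u) p) (hb : DifferentiableAt ℝ (Yg u) p)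
    (h : 0 < (Xg u p) ^ 2 + (Yg u p) ^ 2) :
    (Xg (Xg u) p) ^ 2 + (Xg (Yg u) p) ^ 2 + (Yg (Xg u) p) ^ 2 + (Yg (Yg u) p) ^ 2
      - (Xg (normG u) p) ^ 2 - (Yg (normG u) p) ^ 2 = regularizedHessianDefect 0 u p := by
  have hn : normG u = fun q => √(Xg u q ^ 2 + Yg u q ^ 2 + 0) := by
    funext q
    rw [add_zero, normG]
  have h' : Xg u p ^ 2 + Yg u p ^ 2 + 0 ≠ 0 := by linarith
  rw [hn, Xg_sqrt_sq_add_sq ha hb h', Yg_sqrt_sq_add_sq ha hb h', regularizedHessianDefect,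
    div_pow, div_pow, Real.sq_sqrt (by positivity)]
  ring

theorem sum_sq_grushin_gradient_mul_sqrt {u ζ : ℝ × ℝ → ℝ} {s : Set (ℝ × ℝ)} (hs : IsOpen s)
    (hu : ContDiffOn ℝ 3 u s) (hζ : ContDiff ℝ 2 ζ) {δ : ℝ} (hδ : 0 < δ) {p : ℝ × ℝ}
    (hp : p ∈ s) :
    (Xg (fun q => ζ q * √(Xg u q ^ 2 + Yg u q ^ 2 + δ)) p) ^ 2
        + (Yg (fun q => ζ q * √(Xg u q ^ 2 + Yg u q ^ 2 + δ)) p) ^ 2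
      = ((Xg ζ p) ^ 2 + (Yg ζ p) ^ 2) * (√(Xg u p ^ 2 + Yg u p ^ 2 + δ) *
          √(Xg u p ^ 2 + Yg u p ^ 2 + δ))
        + Xg (fun q => ζ q * (ζ q * (Xg u q * Xg (Xg u) q + Yg u q * Xg (Yg u) q))) p
        + Yg (fun q => ζ q * (ζ q * (Xg u q * Yg (Xg u) q + Yg u q * Yg (Yg u) q))) p
        - regularizedHessianDefect δ u p * ζ p ^ 2
        - (Xg u p * Xg (deltaG u) p + Yg u p * Yg (deltaG u) p) * ζ p ^ 2
        + 2 * ((Zg (Yg u) p * Xg u p - Zg (Xg u) p * Yg u p) * ζ p ^ 2) := by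
  have ha : ContDiffOn ℝ 2 (Xg u) s := ContDiffOn.Xg hs hu (by norm_num)
  have hb : ContDiffOn ℝ 2 (Yg u) s := ContDiffOn.Yg hs hu (by norm_num)
  have da := (ha.of_le (m := 1) (by norm_num)).differentiableAt_of_isOpen hs hp
  have db := (hb.of_le (m := 1) (by norm_num)).differentiableAt_of_isOpen hs hp
  have dax := (ContDiffOn.Xg (m := 1) hs ha (by norm_num)).differentiableAt_of_isOpen hs hp
  have day := (ContDiffOn.Yg (m := 1) hs ha (by norm_num)).differentiableAt_of_isOpen hs hp
  have dbx := (ContDiffOn.Xg (m := 1) hs hb (by norm_num)).differentiableAt_of_isOpen hs hp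
  have dby := (ContDiffOn.Yg (m := 1) hs hb (by norm_num)).differentiableAt_of_isOpen hs hp
  have dζ : DifferentiableAt ℝ ζ p := hζ.differentiable (by norm_num) p
  have hpos : 0 < Xg u p ^ 2 + Yg u p ^ 2 + δ := by positivity
  have dw : DifferentiableAt ℝ (fun q => √(Xg u q ^ 2 + Yg u q ^ 2 + δ)) p :=
    (((da.fun_pow 2).fun_add (db.fun_pow 2)).add_const δ).sqrt hpos.ne'
  have e1 := deltaG_Xg hs hu hp
  have e2 := deltaG_Yg hs hu hp
  rw [deltaG] at e1 e2
  rw [Xg_mul dζ dw, Yg_mul dζ dw, Xg_sqrt_sq_add_sq da db hpos.ne',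
    Yg_sqrt_sq_add_sq da db hpos.ne', Xg_mul dζ (dζ.fun_mul ((da.fun_mul dax).fun_add
    (db.fun_mul dbx))), Xg_mul dζ ((da.fun_mul dax).fun_add (db.fun_mul dbx)),
    Xg_add (da.fun_mul dax) (db.fun_mul dbx), Xg_mul da dax, Xg_mul db dbx,
    Yg_mul dζ (dζ.fun_mul ((da.fun_mul day).fun_add (db.fun_mul dby))),
    Yg_mul dζ ((da.fun_mul day).fun_add (db.fun_mul dby)),
    Yg_add (da.fun_mul day) (db.fun_mul dby), Yg_mul da day, Yg_mul db dby,
    regularizedHessianDefect]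
  have hw : √(Xg u p ^ 2 + Yg u p ^ 2 + δ) ^ 2 = Xg u p ^ 2 + Yg u p ^ 2 + δ :=
    Real.sq_sqrt hpos.le
  have hw0 : √(Xg u p ^ 2 + Yg u p ^ 2 + δ) ≠ 0 := (Real.sqrt_pos.2 hpos).ne'
  have e1' : Xg (deltaG u) p = Xg (Xg (Xg u)) p + Yg (Yg (Xg u)) p + 2 * Zg (Yg u) p := by
    linarith only [e1]
  have e2' : Yg (deltaG u) p = Xg (Xg (Yg u)) p + Yg (Yg (Yg u)) p - 2 * Zg (Xg u) p := by
    linarith only [e2]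
  rw [e1', e2']
  generalize √(Xg u p ^ 2 + Yg u p ^ 2 + δ) = w at *
  rw [← hw]
  field_simp
  ring

theorem integral_add_add_sub_sub_add_two_mul {α : Type*} [MeasurableSpace α] {μ : Measure α}
    {a b c d e f : α → ℝ} (ha : Integrable a μ) (hb : Integrable b μ) (hc : Integrable c μ)
    (hd : Integrable d μ) (he : Integrable e μ) (hf : Integrable f μ) :
    ∫ p, (a p + b p + c p - d p - e p + 2 * f p) ∂μ =
      ∫ p, a p ∂μ + ∫ p, b p ∂μ + ∫ p, c p ∂μ - ∫ p, d p ∂μ - ∫ p, e p ∂μ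
        + 2 * ∫ p, f p ∂μ := by
  have h1 : Integrable (fun p => a p + b p) μ := ha.add hb
  have h2 : Integrable (fun p => a p + b p + c p) μ := h1.add hc
  have h3 : Integrable (fun p => a p + b p + c p - d p) μ := h2.sub hd
  have h4 : Integrable (fun p => a p + b p + c p - d p - e p) μ := h3.sub he
  rw [integral_add h4 (hf.const_mul 2), integral_sub h3 he, integral_sub h2 hd,
    integral_add h1 hc, integral_add ha hb, integral_const_mul]

theorem setIntegral_grushin_stability_le {u ζ : ℝ × ℝ → ℝ} {s : Set (ℝ × ℝ)}
    (hs : IsOpen s)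
    (hu : ContDiffOn ℝ 3 u s) (hζ : ContDiff ℝ 2 ζ) (hζc : HasCompactSupport ζ)
    (hζs : tsupport ζ ⊆ s) {δ : ℝ} (hδ : 0 < δ) :
    (∫ p in s, ((Xg (fun q => ζ q * √(Xg u q ^ 2 + Yg u q ^ 2 + δ)) p) ^ 2
        + (Yg (fun q => ζ q * √(Xg u q ^ 2 + Yg u q ^ 2 + δ)) p) ^ 2))
      + (∫ p in s ∩ {q | normG u q ≠ 0},
        ((Xg (Xg u) p) ^ 2 + (Xg (Yg u) p) ^ 2 + (Yg (Xg u) p) ^ 2 + (Yg (Yg u) p) ^ 2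
          - (Xg (normG u) p) ^ 2 - (Yg (normG u) p) ^ 2) * (ζ p) ^ 2)
      + (∫ p in s, (Xg u p * Xg (deltaG u) p + Yg u p * Yg (deltaG u) p) * ζ p ^ 2)
      - 2 * (∫ p in s, (Zg (Yg u) p * Xg u p - Zg (Xg u) p * Yg u p) * ζ p ^ 2)
      ≤ ∫ p in s, ((Xg ζ p) ^ 2 + (Yg ζ p) ^ 2) * (√(Xg u p ^ 2 + Yg u p ^ 2 + δ) *
          √(Xg u p ^ 2 + Yg u p ^ 2 + δ)) := by
  have ha : ContDiffOn ℝ 2 (Xg u) s := ContDiffOn.Xg hs hu (by norm_num)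
  have hb : ContDiffOn ℝ 2 (Yg u) s := ContDiffOn.Yg hs hu (by norm_num)
  have ha1 : ContDiffOn ℝ 1 (Xg u) s := ha.of_le (by norm_num)
  have hb1 : ContDiffOn ℝ 1 (Yg u) s := hb.of_le (by norm_num)
  have hax : ContDiffOn ℝ 1 (Xg (Xg u)) s := ContDiffOn.Xg hs ha (by norm_num)
  have hay : ContDiffOn ℝ 1 (Yg (Xg u)) s := ContDiffOn.Yg hs ha (by norm_num)
  have hbx : ContDiffOn ℝ 1 (Xg (Yg u)) s := ContDiffOn.Xg hs hb (by norm_num)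
  have hby : ContDiffOn ℝ 1 (Yg (Yg u)) s := ContDiffOn.Yg hs hb (by norm_num)
  have hΔ : ContDiffOn ℝ 1 (deltaG u) s := hax.add hby
  have ca := ha.continuousOn
  have cb := hb.continuousOn
  have cax := hax.continuousOn
  have cay := hay.continuousOn
  have cbx := hbx.continuousOn
  have cby := hby.continuousOn
  have cza : ContinuousOn (Zg (Xg u)) s :=
    (ContDiffOn.pdy (m := 0) hs ha1 (by simp)).continuousOn
  have czb : ContinuousOn (Zg (Yg u)) s :=
    (ContDiffOn.pdy (m := 0) hs hb1 (by simp)).continuousOn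
  have cΔx : ContinuousOn (Xg (deltaG u)) s :=
    (ContDiffOn.Xg (m := 0) hs hΔ (by simp)).continuousOn
  have cΔy : ContinuousOn (Yg (deltaG u)) s :=
    (ContDiffOn.Yg (m := 0) hs hΔ (by simp)).continuousOn
  have hζ1 : ContDiff ℝ 1 ζ := hζ.of_le (by norm_num)
  have cζ : ContinuousOn ζ s := hζ.continuous.continuousOn
  have cζx : ContinuousOn (Xg ζ) s := (continuous_pdx hζ1).continuousOn
  have cζy : ContinuousOn (Yg ζ) s :=
    (continuous_fst.mul (continuous_pdy hζ1)).continuousOn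
  have hpos : ∀ p, 0 < Xg u p ^ 2 + Yg u p ^ 2 + δ := fun p => by positivity
  have cG : ContinuousOn (regularizedHessianDefect δ u) s := by
    unfold regularizedHessianDefect
    refine ContinuousOn.sub (by fun_prop) (ContinuousOn.div (by fun_prop) (by fun_prop) ?_)
    exact fun p _ => (hpos p).ne'
  have h0 : ∀ p ∉ tsupport ζ, ζ p = 0 := fun p hp => image_eq_zero_of_notMem_tsupport hp
  have h0x : ∀ p ∉ tsupport ζ, Xg ζ p = 0 := fun p hp => pdx_eq_zero_of_notMem_tsupport hp
  have h0y : ∀ p ∉ tsupport ζ, Yg ζ p = 0 := fun p hp => Yg_eq_zero_of_notMem_tsupport hp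
  have hV1 : ContDiff ℝ 1
      (fun q => ζ q * (ζ q * (Xg u q * Xg (Xg u) q + Yg u q * Xg (Yg u) q))) :=
    contDiff_mul_of_tsupport_subset hs hζ1 hζs
      (hζ1.contDiffOn.mul ((ha1.mul hax).add (hb1.mul hbx)))
  have hV2 : ContDiff ℝ 1
      (fun q => ζ q * (ζ q * (Xg u q * Yg (Xg u) q + Yg u q * Yg (Yg u) q))) :=
    contDiff_mul_of_tsupport_subset hs hζ1 hζs
      (hζ1.contDiffOn.mul ((ha1.mul hay).add (hb1.mul hby)))
  have sV : ∀ f : ℝ × ℝ → ℝ, tsupport (fun q => ζ q * f q) ⊆ tsupport ζ :=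
    fun f => tsupport_mul_subset_left
  have iV1 : IntegrableOn
      (Xg fun q => ζ q * (ζ q * (Xg u q * Xg (Xg u) q + Yg u q * Xg (Yg u) q))) s :=
    ContinuousOn.integrableOn_of_eq_zero_off_compact hs (continuous_pdx hV1).continuousOn hζc hζs
      fun p hp => pdx_eq_zero_of_notMem_tsupport fun h => hp (sV _ h)
  have iV2 : IntegrableOn
      (Yg fun q => ζ q * (ζ q * (Xg u q * Yg (Xg u) q + Yg u q * Yg (Yg u) q))) s :=
    ContinuousOn.integrableOn_of_eq_zero_off_compact hs
      (continuous_fst.mul (continuous_pdy hV2)).continuousOn hζc hζs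
      fun p hp => Yg_eq_zero_of_notMem_tsupport fun h => hp (sV _ h)
  have iG : IntegrableOn (fun p => regularizedHessianDefect δ u p * ζ p ^ 2) s :=
    ContinuousOn.integrableOn_of_eq_zero_off_compact hs (by fun_prop) hζc hζs
      fun p hp => by simp [h0 p hp]
  have iR : IntegrableOn
      (fun p => (Xg u p * Xg (deltaG u) p + Yg u p * Yg (deltaG u) p) * ζ p ^ 2) s :=
    ContinuousOn.integrableOn_of_eq_zero_off_compact hs (by fun_prop) hζc hζs
      fun p hp => by simp [h0 p hp]
  have iC : IntegrableOn
      (fun p => (Zg (Yg u) p * Xg u p - Zg (Xg u) p * Yg u p) * ζ p ^ 2) s :=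
    ContinuousOn.integrableOn_of_eq_zero_off_compact hs (by fun_prop) hζc hζs
      fun p hp => by simp [h0 p hp]
  have iW : IntegrableOn (fun p => ((Xg ζ p) ^ 2 + (Yg ζ p) ^ 2) *
      (√(Xg u p ^ 2 + Yg u p ^ 2 + δ) * √(Xg u p ^ 2 + Yg u p ^ 2 + δ))) s :=
    ContinuousOn.integrableOn_of_eq_zero_off_compact hs (by fun_prop) hζc hζs
      fun p hp => by simp [h0x p hp, h0y p hp]
  have hF : (∫ p in s ∩ {q | normG u q ≠ 0},
        ((Xg (Xg u) p) ^ 2 + (Xg (Yg u) p) ^ 2 + (Yg (Xg u) p) ^ 2 + (Yg (Yg u) p) ^ 2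
          - (Xg (normG u) p) ^ 2 - (Yg (normG u) p) ^ 2) * (ζ p) ^ 2)
      ≤ ∫ p in s, regularizedHessianDefect δ u p * ζ p ^ 2 := by
    have cn : ContinuousOn (normG u) s := by
      unfold normG
      fun_prop
    have mS : MeasurableSet (s ∩ {q | normG u q ≠ 0}) :=
      (cn.isOpen_inter_preimage hs isOpen_ne).measurableSet
    have key : ∀ p ∈ s ∩ {q | normG u q ≠ 0},
        ((Xg (Xg u) p) ^ 2 + (Xg (Yg u) p) ^ 2 + (Yg (Xg u) p) ^ 2 + (Yg (Yg u) p) ^ 2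
          - (Xg (normG u) p) ^ 2 - (Yg (normG u) p) ^ 2) = regularizedHessianDefect 0 u p ∧
        regularizedHessianDefect 0 u p ≤ regularizedHessianDefect δ u p := by
      rintro p ⟨hp, hn⟩
      have h : 0 < (Xg u p) ^ 2 + (Yg u p) ^ 2 := Real.sqrt_ne_zero'.1 hn
      exact ⟨regularizedHessianDefect_zero_eq (ha1.differentiableAt_of_isOpen hs hp)
        (hb1.differentiableAt_of_isOpen hs hp) h, regularizedHessianDefect_zero_le hδ.le h⟩
    refine (integral_mono_of_nonneg ?_ (iG.mono_set Set.inter_subset_left) ?_).trans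
      (setIntegral_mono_set iG ?_ Set.inter_subset_left.eventuallyLE)
    · filter_upwards [ae_restrict_mem mS] with p hp
      rw [(key p hp).1]
      exact mul_nonneg (regularizedHessianDefect_nonneg le_rfl u p) (sq_nonneg _)
    · filter_upwards [ae_restrict_mem mS] with p hp
      rw [(key p hp).1]
      exact mul_le_mul_of_nonneg_right (key p hp).2 (sq_nonneg _)
    · exact Eventually.of_forall fun p =>
        mul_nonneg (regularizedHessianDefect_nonneg hδ.le u p) (sq_nonneg _)
  rw [setIntegral_congr_fun hs.measurableSet fun p hp =>
    sum_sq_grushin_gradient_mul_sqrt hs hu hζ hδ hp]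
  rw [integral_add_add_sub_sub_add_two_mul iW iV1 iV2 iG iR iC,
    setIntegral_Xg_eq_zero hV1 (hζc.mono' ((subset_tsupport _).trans (sV _))) ((sV _).trans hζs),
    setIntegral_Yg_eq_zero hV2 (hζc.mono' ((subset_tsupport _).trans (sV _))) ((sV _).trans hζs)]
  linarith

theorem clm_apply_eq_sum_single {m : ℕ} (L : (Fin m → ℝ) →L[ℝ] ℝ) (d : Fin m → ℝ) :
    L d = ∑ j, L (Pi.single j 1) * d j := by
  conv_lhs => rw [pi_eq_sum_univ' d]
  rw [map_sum]
  refine Finset.sum_congr rfl fun j _ => ?_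
  rw [map_smul, smul_eq_mul, mul_comm]

theorem Xg_comp_eq_sum {m : ℕ} {H : (Fin m → ℝ) → ℝ} {u : Fin m → ℝ × ℝ → ℝ} {p : ℝ × ℝ}
    (hH : DifferentiableAt ℝ H (fun k => u k p)) (hu : ∀ k, DifferentiableAt ℝ (u k) p) :
    Xg (fun q => H (fun k => u k q)) p = ∑ j, pdH H j (fun k => u k p) * Xg (u j) p := by
  have h1 : HasDerivAt (fun t k => u k (t, p.2)) (fun k => Xg (u k) p) p.1 := by
    refine hasDerivAt_pi.2 fun k => ?_
    have : DifferentiableAt ℝ (fun t : ℝ => u k (t, p.2)) p.1 :=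
      DifferentiableAt.comp (f := fun t : ℝ => (t, p.2)) p.1 (hu k) (by fun_prop)
    exact this.hasDerivAt
  have h2 := (HasFDerivAt.comp_hasDerivAt (f := fun t k => u k (t, p.2)) p.1 hH.hasFDerivAt
    h1).deriv
  exact h2.trans (clm_apply_eq_sum_single _ _)

theorem Yg_comp_eq_sum {m : ℕ} {H : (Fin m → ℝ) → ℝ} {u : Fin m → ℝ × ℝ → ℝ} {p : ℝ × ℝ}
    (hH : DifferentiableAt ℝ H (fun k => u k p)) (hu : ∀ k, DifferentiableAt ℝ (u k) p) :
    Yg (fun q => H (fun k => u k q)) p = ∑ j, pdH H j (fun k => u k p) * Yg (u j) p := by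
  have h1 : HasDerivAt (fun t k => u k (p.1, t)) (fun k => pdy (u k) p) p.2 := by
    refine hasDerivAt_pi.2 fun k => ?_
    have : DifferentiableAt ℝ (fun t : ℝ => u k (p.1, t)) p.2 :=
      DifferentiableAt.comp (f := fun t : ℝ => (p.1, t)) p.2 (hu k) (by fun_prop)
    exact this.hasDerivAt
  have h2 := (HasFDerivAt.comp_hasDerivAt (f := fun t k => u k (p.1, t)) p.2 hH.hasFDerivAt
    h1).deriv
  have h3 := h2.trans (clm_apply_eq_sum_single _ _)
  change p.1 * deriv (H ∘ fun t k => u k (p.1, t)) p.2 = _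
  rw [h3, Finset.mul_sum]
  refine Finset.sum_congr rfl fun j _ => ?_
  rw [pdH, Yg]
  ring

/-- Intermediate geometric Poincaré inequality for stable solutions of the
symmetric Grushin system on an open set `Ω ⊆ ℝ²`. -/
theorem stmt_3 {m : ℕ} (Ω : Set (ℝ × ℝ)) (hΩ : IsOpen Ω)
    (H : Fin m → (Fin m → ℝ) → ℝ) (hH : ∀ i, ContDiff ℝ 1 (H i))
    (hsymm : ∀ i j v, pdH (H j) i v = pdH (H i) j v)
    (u : Fin m → ℝ × ℝ → ℝ) (hu : ∀ i, ContDiffOn ℝ 3 (u i) Ω)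
    (hsys : ∀ i, ∀ p ∈ Ω, deltaG (u i) p = H i (fun j => u j p))
    -- stability: the stability inequality holds for all compactly supported C¹ test functions
    (hstab : ∀ ζ : Fin m → ℝ × ℝ → ℝ, (∀ i, ContDiff ℝ 1 (ζ i)) →
      (∀ i, HasCompactSupport (ζ i)) → (∀ i, tsupport (ζ i) ⊆ Ω) →
      (-(∑ i, ∑ j, ∫ p in Ω, pdH (H j) i (fun k => u k p) * ζ i p * ζ j p))
        ≤ ∑ i, ∫ p in Ω, ((Xg (ζ i) p) ^ 2 + (Yg (ζ i) p) ^ 2))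
    (ζ : Fin m → ℝ × ℝ → ℝ) (hζ : ∀ i, ContDiff ℝ 2 (ζ i))
    (hζc : ∀ i, HasCompactSupport (ζ i)) (hζΩ : ∀ i, tsupport (ζ i) ⊆ Ω) :
    (∑ i, ∫ p in Ω ∩ {q | normG (u i) q ≠ 0},
        ((Xg (Xg (u i)) p) ^ 2 + (Xg (Yg (u i)) p) ^ 2 + (Yg (Xg (u i)) p) ^ 2
          + (Yg (Yg (u i)) p) ^ 2
          - (Xg (normG (u i)) p) ^ 2 - (Yg (normG (u i)) p) ^ 2) * (ζ i p) ^ 2)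
      - (2 * ∑ i, ∫ p in Ω,
          (Zg (Yg (u i)) p * Xg (u i) p - Zg (Xg (u i)) p * Yg (u i) p) * (ζ i p) ^ 2)
      + (∑ i, ∑ j ∈ Finset.univ.erase i, ∫ p in Ω,
          pdH (H i) j (fun k => u k p) *
            ((Xg (u i) p * Xg (u j) p + Yg (u i) p * Yg (u j) p) * (ζ i p) ^ 2
              - normG (u i) p * normG (u j) p * ζ i p * ζ j p))
      ≤ ∑ i, ∫ p in Ω, (normG (u i) p) ^ 2 * ((Xg (ζ i) p) ^ 2 + (Yg (ζ i) p) ^ 2) := by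
  have ha : ∀ i, ContDiffOn ℝ 2 (Xg (u i)) Ω := fun i => ContDiffOn.Xg hΩ (hu i) (by norm_num)
  have hb : ∀ i, ContDiffOn ℝ 2 (Yg (u i)) Ω := fun i => ContDiffOn.Yg hΩ (hu i) (by norm_num)
  have ca : ∀ i, ContinuousOn (Xg (u i)) Ω := fun i => (ha i).continuousOn
  have cb : ∀ i, ContinuousOn (Yg (u i)) Ω := fun i => (hb i).continuousOn
  have cN : ∀ i, ContinuousOn (fun p => Xg (u i) p ^ 2 + Yg (u i) p ^ 2) Ω := fun i =>
    ((ca i).pow 2).add ((cb i).pow 2)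
  have hζ1 : ∀ i, ContDiff ℝ 1 (ζ i) := fun i => (hζ i).of_le (by norm_num)
  have cζ : ∀ i, ContinuousOn (ζ i) Ω := fun i => (hζ i).continuous.continuousOn
  have cζx : ∀ i, ContinuousOn (Xg (ζ i)) Ω := fun i => (continuous_pdx (hζ1 i)).continuousOn
  have cζy : ∀ i, ContinuousOn (Yg (ζ i)) Ω := fun i =>
    (continuous_fst.mul (continuous_pdy (hζ1 i))).continuousOn
  have h0 : ∀ i, ∀ p ∉ tsupport (ζ i), ζ i p = 0 := fun i p hp =>
    image_eq_zero_of_notMem_tsupport hp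
  have cH : ∀ i j, ContinuousOn (fun p => pdH (H i) j (fun k => u k p)) Ω := fun i j => by
    have h1 : Continuous (fun v => pdH (H i) j v) :=
      ((hH i).continuous_fderiv (by norm_num)).clm_apply continuous_const
    exact h1.comp_continuousOn (continuousOn_pi.2 fun k => (hu k).continuousOn)
  have iP : ∀ i j, IntegrableOn (fun p => pdH (H i) j (fun k => u k p) *
      ((Xg (u i) p * Xg (u j) p + Yg (u i) p * Yg (u j) p) * ζ i p ^ 2)) Ω := fun i j =>
    ContinuousOn.integrableOn_of_eq_zero_off_compact hΩ
      ((cH i j).mul ((((ca i).mul (ca j)).add ((cb i).mul (cb j))).mul ((cζ i).pow 2)))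
      (hζc i) (hζΩ i) fun p hp => by simp [h0 i p hp]
  have iQ : ∀ i j, IntegrableOn (fun p => pdH (H j) i (fun k => u k p) * ζ i p * ζ j p *
      (normG (u i) p * normG (u j) p)) Ω := fun i j =>
    ContinuousOn.integrableOn_of_eq_zero_off_compact hΩ
      ((((cH j i).mul (cζ i)).mul (cζ j)).mul ((cN i).sqrt.mul (cN j).sqrt))
      (hζc i) (hζΩ i) fun p hp => by simp [h0 i p hp]
  have hR : ∀ i, ∫ p in Ω, (Xg (u i) p * Xg (deltaG (u i)) p + Yg (u i) p * Yg (deltaG (u i)) p)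
      * ζ i p ^ 2 = ∑ j, ∫ p in Ω, pdH (H i) j (fun k => u k p) *
        ((Xg (u i) p * Xg (u j) p + Yg (u i) p * Yg (u j) p) * ζ i p ^ 2) := by
    intro i
    rw [← integral_finsetSum _ fun j _ => iP i j]
    refine setIntegral_congr_fun hΩ.measurableSet fun p hp => ?_
    have hd : ∀ k, DifferentiableAt ℝ (u k) p := fun k =>
      ((hu k).of_le (by norm_num)).differentiableAt_of_isOpen hΩ hp
    have hHd : DifferentiableAt ℝ (H i) (fun k => u k p) :=
      (hH i).differentiable (by norm_num) _
    have hx : Xg (deltaG (u i)) p = ∑ j, pdH (H i) j (fun k => u k p) * Xg (u j) p :=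
      (pdx_congr hΩ (hsys i) hp).trans (Xg_comp_eq_sum hHd hd)
    have hy : Yg (deltaG (u i)) p = ∑ j, pdH (H i) j (fun k => u k p) * Yg (u j) p :=
      (congrArg (p.1 * ·) (pdy_congr hΩ (hsys i) hp)).trans (Yg_comp_eq_sum hHd hd)
    simp only [hx, hy, Finset.mul_sum, Finset.sum_mul, ← Finset.sum_add_distrib]
    refine Finset.sum_congr rfl fun j _ => ?_
    ring
  have hn : ∀ i p, normG (u i) p * normG (u i) p = Xg (u i) p ^ 2 + Yg (u i) p ^ 2 :=
    fun i p => Real.mul_self_sqrt (by positivity)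
  have hoff : ∀ i, ∑ j ∈ Finset.univ.erase i, ∫ p in Ω,
      pdH (H i) j (fun k => u k p) *
        ((Xg (u i) p * Xg (u j) p + Yg (u i) p * Yg (u j) p) * (ζ i p) ^ 2
          - normG (u i) p * normG (u j) p * ζ i p * ζ j p) =
      (∑ j, ∫ p in Ω, pdH (H i) j (fun k => u k p) *
        ((Xg (u i) p * Xg (u j) p + Yg (u i) p * Yg (u j) p) * ζ i p ^ 2))
      - ∑ j, ∫ p in Ω, pdH (H j) i (fun k => u k p) * ζ i p * ζ j p *
        (normG (u i) p * normG (u j) p) := by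
    intro i
    rw [Finset.sum_erase, ← Finset.sum_sub_distrib]
    · refine Finset.sum_congr rfl fun j _ => ?_
      rw [← integral_sub (iP i j) (iQ i j)]
      refine integral_congr_ae (Eventually.of_forall fun p => ?_)
      simp only [hsymm i j]
      ring
    · refine integral_eq_zero_of_ae (Eventually.of_forall fun p => ?_)
      simp only [hn, Pi.zero_apply]
      ring
  have hreg : ∀ n : ℕ,
      (∑ i, ((∫ p in Ω ∩ {q | normG (u i) q ≠ 0},
        ((Xg (Xg (u i)) p) ^ 2 + (Xg (Yg (u i)) p) ^ 2 + (Yg (Xg (u i)) p) ^ 2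
          + (Yg (Yg (u i)) p) ^ 2
          - (Xg (normG (u i)) p) ^ 2 - (Yg (normG (u i)) p) ^ 2) * (ζ i p) ^ 2)
        + (∑ j, ∫ p in Ω, pdH (H i) j (fun k => u k p) *
          ((Xg (u i) p * Xg (u j) p + Yg (u i) p * Yg (u j) p) * ζ i p ^ 2))
        - 2 * ∫ p in Ω,
          (Zg (Yg (u i)) p * Xg (u i) p - Zg (Xg (u i)) p * Yg (u i) p) * (ζ i p) ^ 2))
      - ∑ i, ∑ j, ∫ p in Ω, pdH (H j) i (fun k => u k p) * ζ i p * ζ j p *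
        (√(Xg (u i) p ^ 2 + Yg (u i) p ^ 2 + 1 / ((n : ℝ) + 1)) *
          √(Xg (u j) p ^ 2 + Yg (u j) p ^ 2 + 1 / ((n : ℝ) + 1)))
      ≤ ∑ i, ∫ p in Ω, ((Xg (ζ i) p) ^ 2 + (Yg (ζ i) p) ^ 2) *
        (√(Xg (u i) p ^ 2 + Yg (u i) p ^ 2 + 1 / ((n : ℝ) + 1)) *
          √(Xg (u i) p ^ 2 + Yg (u i) p ^ 2 + 1 / ((n : ℝ) + 1))) := by
    intro n
    have hδ : (0 : ℝ) < 1 / ((n : ℝ) + 1) := by positivity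
    generalize 1 / ((n : ℝ) + 1) = δ at hδ ⊢
    have hstabδ := hstab (fun i q => ζ i q * √(Xg (u i) q ^ 2 + Yg (u i) q ^ 2 + δ))
      (fun i => contDiff_mul_of_tsupport_subset hΩ (hζ1 i) (hζΩ i)
        (((((ha i).pow 2).add ((hb i).pow 2)).add contDiffOn_const).sqrt
          (fun p _ => (by positivity : 0 < Xg (u i) p ^ 2 + Yg (u i) p ^ 2 + δ).ne')
          |>.of_le (by norm_num)))
      (fun i => (hζc i).mul_right)
      (fun i => tsupport_mul_subset_left.trans (hζΩ i))
    have hsum := Finset.sum_le_sum fun i (_ : i ∈ Finset.univ) =>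
      setIntegral_grushin_stability_le hΩ (hu i) (hζ i) (hζc i) (hζΩ i) hδ
    simp only [hR, Finset.sum_sub_distrib, Finset.sum_add_distrib] at hsum ⊢
    have hQ : ∑ i, ∑ j, ∫ p in Ω, pdH (H j) i (fun k => u k p) * ζ i p * ζ j p *
        (√(Xg (u i) p ^ 2 + Yg (u i) p ^ 2 + δ) * √(Xg (u j) p ^ 2 + Yg (u j) p ^ 2 + δ)) =
      ∑ i, ∑ j, ∫ p in Ω, pdH (H j) i (fun k => u k p) *
        (ζ i p * √(Xg (u i) p ^ 2 + Yg (u i) p ^ 2 + δ)) *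
        (ζ j p * √(Xg (u j) p ^ 2 + Yg (u j) p ^ 2 + δ)) := by
      refine Finset.sum_congr rfl fun i _ => Finset.sum_congr rfl fun j _ =>
        integral_congr_ae (Eventually.of_forall fun p => ?_)
      ring
    rw [hQ]
    linarith
  have hlim := le_of_tendsto_of_tendsto'
    ((tendsto_finsetSum Finset.univ fun i _ => tendsto_finsetSum Finset.univ fun j _ =>
      tendsto_setIntegral_mul_sqrt_mul_sqrt hΩ (((cH j i).mul (cζ i)).mul (cζ j)) (cN i) (cN j)
        (hζc i) (hζΩ i) fun p hp => by simp [h0 i p hp]).const_sub _)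
    (tendsto_finsetSum Finset.univ fun i _ =>
      tendsto_setIntegral_mul_sqrt_mul_sqrt hΩ (((cζx i).pow 2).add ((cζy i).pow 2)) (cN i)
        (cN i) (hζc i) (hζΩ i) fun p hp => by
          simp [Xg, pdx_eq_zero_of_notMem_tsupport hp, Yg_eq_zero_of_notMem_tsupport hp])
    hreg
  have hT : ∑ i, ∫ p in Ω, (normG (u i) p) ^ 2 * ((Xg (ζ i) p) ^ 2 + (Yg (ζ i) p) ^ 2) =
      ∑ i, ∫ p in Ω, ((Xg (ζ i) p) ^ 2 + (Yg (ζ i) p) ^ 2) *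
        (normG (u i) p * normG (u i) p) := by
    refine Finset.sum_congr rfl fun i _ => integral_congr_ae (Eventually.of_forall fun p => ?_)
    ring
  rw [hT]
  simp only [hoff, Finset.sum_sub_distrib, Finset.sum_add_distrib, ← Finset.mul_sum] at hlim ⊢
  change _ - (∑ i, ∑ j, ∫ p in Ω, pdH (H j) i (fun k => u k p) * ζ i p * ζ j p *
    (normG (u i) p * normG (u j) p)) ≤ ∑ i, ∫ p in Ω, ((Xg (ζ i) p) ^ 2 + (Yg (ζ i) p) ^ 2) *
      (normG (u i) p * normG (u i) p) at hlim
  linarith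
end

section
/- Let m ≥ 1, let H̃ ∈ C¹(ℝ^m) with H_i = ∂_iH̃, let f_1,…,f_m : ℝ → ℝ be continuous, and let u_i ∈ C²(ℝ²) satisfy ∂_xx u_i(x,y) + f_i(x)²·∂_yy u_i(x,y) = H_i(u_1(x,y),…,u_m(x,y)) on ℝ². For R > 0 define I_R(y) = ∫_{−R}^{R} ( Σ_{i=1}^m ½·[(∂_x u_i(x,y))² − f_i(x)²·(∂_y u_i(x,y))²] + H̃(u(x,y)) ) dx. Then for every R > 0 and every y ∈ ℝ, I_R(y) − I_R(0) = Σ_{i=1}^m ∫_0^y [∂_x u_i(R,s)·∂_y u_i(R,s) − ∂_x u_i(−R,s)·∂_y u_i(−R,s)] ds. -/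
open MeasureTheory Real Filter

lemma hasDerivAt_fst_fderiv {u : ℝ × ℝ → ℝ} {n : WithTop ℕ∞} (hu : ContDiff ℝ n u) (hn : n ≠ 0)
    (p : ℝ × ℝ) : HasDerivAt (fun t => u (t, p.2)) (fderiv ℝ u p (1, 0)) p.1 :=
  ((hu.differentiable hn) p).hasFDerivAt.comp_hasDerivAt p.1
    ((hasDerivAt_id p.1).prodMk (hasDerivAt_const p.1 p.2))

lemma hasDerivAt_snd_fderiv {u : ℝ × ℝ → ℝ} {n : WithTop ℕ∞} (hu : ContDiff ℝ n u) (hn : n ≠ 0)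
    (p : ℝ × ℝ) : HasDerivAt (fun t => u (p.1, t)) (fderiv ℝ u p (0, 1)) p.2 :=
  ((hu.differentiable hn) p).hasFDerivAt.comp_hasDerivAt p.2
    ((hasDerivAt_const p.2 p.1).prodMk (hasDerivAt_id p.2))

lemma pdx_eq_fderiv_s8 {u : ℝ × ℝ → ℝ} {n : WithTop ℕ∞} (hu : ContDiff ℝ n u) (hn : n ≠ 0) :
    pdx u = fun p => fderiv ℝ u p (1, 0) :=
  funext fun p => (hasDerivAt_fst_fderiv hu hn p).deriv

lemma pdy_eq_fderiv_s8 {u : ℝ × ℝ → ℝ} {n : WithTop ℕ∞} (hu : ContDiff ℝ n u) (hn : n ≠ 0) :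
    pdy u = fun p => fderiv ℝ u p (0, 1) :=
  funext fun p => (hasDerivAt_snd_fderiv hu hn p).deriv

lemma hasDerivAt_pdx {u : ℝ × ℝ → ℝ} (hu : ContDiff ℝ 1 u) (x y : ℝ) :
    HasDerivAt (fun t => u (t, y)) (pdx u (x, y)) x :=
  (hasDerivAt_fst_fderiv hu one_ne_zero (x, y)).differentiableAt.hasDerivAt

lemma hasDerivAt_pdy {u : ℝ × ℝ → ℝ} (hu : ContDiff ℝ 1 u) (x y : ℝ) :
    HasDerivAt (fun t => u (x, t)) (pdy u (x, y)) y :=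
  (hasDerivAt_snd_fderiv hu one_ne_zero (x, y)).differentiableAt.hasDerivAt

lemma continuous_pdx_s8 {u : ℝ × ℝ → ℝ} (hu : ContDiff ℝ 1 u) : Continuous (pdx u) := by
  rw [pdx_eq_fderiv_s8 hu one_ne_zero]
  exact (hu.continuous_fderiv one_ne_zero).clm_apply continuous_const

lemma continuous_pdy_s8 {u : ℝ × ℝ → ℝ} (hu : ContDiff ℝ 1 u) : Continuous (pdy u) := by
  rw [pdy_eq_fderiv_s8 hu one_ne_zero]
  exact (hu.continuous_fderiv one_ne_zero).clm_apply continuous_const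

lemma contDiff_one_pdx {u : ℝ × ℝ → ℝ} (hu : ContDiff ℝ 2 u) : ContDiff ℝ 1 (pdx u) := by
  rw [pdx_eq_fderiv_s8 hu two_ne_zero]
  exact (hu.fderiv_right (by norm_num)).clm_apply contDiff_const

lemma contDiff_one_pdy {u : ℝ × ℝ → ℝ} (hu : ContDiff ℝ 2 u) : ContDiff ℝ 1 (pdy u) := by
  rw [pdy_eq_fderiv_s8 hu two_ne_zero]
  exact (hu.fderiv_right (by norm_num)).clm_apply contDiff_const

/-- Mixed partial derivatives of a `C²` function commute. -/
lemma pdy_pdx_eq_pdx_pdy {u : ℝ × ℝ → ℝ} (hu : ContDiff ℝ 2 u) (p : ℝ × ℝ) :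
    pdy (pdx u) p = pdx (pdy u) p := by
  have hd : DifferentiableAt ℝ (fderiv ℝ u) p :=
    (hu.fderiv_right (m := 1) (by norm_num)).differentiable one_ne_zero p
  have hsymm := hu.contDiffAt.isSymmSndFDerivAt (x := p) (by simp)
  rw [pdy_eq_fderiv_s8 (contDiff_one_pdx hu) one_ne_zero,
    pdx_eq_fderiv_s8 (contDiff_one_pdy hu) one_ne_zero,
    pdx_eq_fderiv_s8 hu two_ne_zero, pdy_eq_fderiv_s8 hu two_ne_zero]
  simp only
  rw [fderiv_clm_apply hd (differentiableAt_const _),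
    fderiv_clm_apply hd (differentiableAt_const _)]
  simpa using hsymm (0, 1) (1, 0)

lemma fderiv_apply_eq_sum_pdH {m : ℕ} (H : (Fin m → ℝ) → ℝ) (v w : Fin m → ℝ) :
    fderiv ℝ H v w = ∑ i, pdH H i v * w i := by
  conv_lhs => rw [← Finset.univ_sum_single w, map_sum]
  refine Finset.sum_congr rfl fun i _ => ?_
  rw [pdH, mul_comm, ← smul_eq_mul, ← map_smul, ← Pi.single_smul, smul_eq_mul, mul_one]

/-- If `∂_y e = ∂_x g`, then the `y`-increment of `∫ e dx` over `[a, b]` is the flux of `g`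
through the two vertical sides. -/
lemma integral_sub_integral_eq_flux {e g D : ℝ → ℝ → ℝ}
    (he : ∀ x y, HasDerivAt (fun t => e x t) (D x y) y)
    (hg : ∀ x y, HasDerivAt (fun t => g t y) (D x y) x)
    (hD : Continuous fun p : ℝ × ℝ => D p.1 p.2)
    (hec : ∀ y, Continuous fun x => e x y) (a b c d : ℝ) :
    (∫ x in a..b, e x d) - ∫ x in a..b, e x c = ∫ s in c..d, (g b s - g a s) := by
  rw [← intervalIntegral.integral_sub ((hec d).intervalIntegrable _ _)
    ((hec c).intervalIntegrable _ _)]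
  have hy : ∀ x, e x d - e x c = ∫ s in c..d, D x s := fun x =>
    (intervalIntegral.integral_eq_sub_of_hasDerivAt (fun s _ => he x s)
      ((hD.comp (by fun_prop : Continuous fun s : ℝ => (x, s))).intervalIntegrable _ _)).symm
  have hx : ∀ s, g b s - g a s = ∫ x in a..b, D x s := fun s =>
    (intervalIntegral.integral_eq_sub_of_hasDerivAt (fun x _ => hg x s)
      ((hD.comp (by fun_prop : Continuous fun x : ℝ => (x, s))).intervalIntegrable _ _)).symm
  simp only [hy, hx]
  exact intervalIntegral_intervalIntegral_swap
    ((hD.continuousOn.integrableOn_compact (isCompact_uIcc.prod isCompact_uIcc)).mono_set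
      (Set.prod_mono Set.uIoc_subset_uIcc Set.uIoc_subset_uIcc))

/-- The finite-radius identity underlying the Hamiltonian identity for
Grushin-type operators `∂ₓₓ + f_i(x)²∂_yy` in two dimensions. -/
theorem stmt_8 {m : ℕ} (hm : 1 ≤ m)
    (Htil : (Fin m → ℝ) → ℝ) (hHtil : ContDiff ℝ 1 Htil)
    (H : Fin m → (Fin m → ℝ) → ℝ) (hHdef : ∀ i v, H i v = pdH Htil i v)
    (f : Fin m → ℝ → ℝ) (hf : ∀ i, Continuous (f i))
    (u : Fin m → ℝ × ℝ → ℝ) (hu : ∀ i, ContDiff ℝ 2 (u i))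
    (hsys : ∀ i p, pdx (pdx (u i)) p + (f i p.1) ^ 2 * pdy (pdy (u i)) p
      = H i (fun j => u j p))
    (IR : ℝ → ℝ → ℝ)
    (hIR : ∀ R y, IR R y = ∫ x in (-R)..R,
      ((∑ i, (1 / 2 : ℝ) * ((pdx (u i) (x, y)) ^ 2 - (f i x) ^ 2 * (pdy (u i) (x, y)) ^ 2))
        + Htil (fun i => u i (x, y)))) :
    ∀ R > (0 : ℝ), ∀ y : ℝ,
      IR R y - IR R 0 = ∑ i, ∫ s in (0 : ℝ)..y,
        (pdx (u i) (R, s) * pdy (u i) (R, s)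
          - pdx (u i) (-R, s) * pdy (u i) (-R, s)) := by
  intro R _ y
  have hu1 i : ContDiff ℝ 1 (u i) := (hu i).of_le (by norm_num)
  have hux i := contDiff_one_pdx (hu i)
  have huy i := contDiff_one_pdy (hu i)
  have cu i : Continuous (u i) := (hu1 i).continuous
  have cux i : Continuous (pdx (u i)) := (hux i).continuous
  have cuy i : Continuous (pdy (u i)) := (huy i).continuous
  have cuxx i : Continuous (pdx (pdx (u i))) := continuous_pdx_s8 (hux i)
  have cuyx i : Continuous (pdx (pdy (u i))) := continuous_pdx_s8 (huy i)
  have cH : Continuous Htil := hHtil.continuous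
  have hflux := integral_sub_integral_eq_flux
    (e := fun x y => (∑ i, (1 / 2 : ℝ) *
      ((pdx (u i) (x, y)) ^ 2 - (f i x) ^ 2 * (pdy (u i) (x, y)) ^ 2))
        + Htil (fun i => u i (x, y)))
    (g := fun x y => ∑ i, pdx (u i) (x, y) * pdy (u i) (x, y))
    (D := fun x y => ∑ i, (pdx (pdx (u i)) (x, y) * pdy (u i) (x, y)
      + pdx (u i) (x, y) * pdx (pdy (u i)) (x, y)))
    (fun x y => ?_)
    (fun x y => HasDerivAt.fun_sum fun i _ =>
      (hasDerivAt_pdx (hux i) x y).mul (hasDerivAt_pdx (huy i) x y))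
    (by fun_prop) (fun y => by fun_prop) (-R) R 0 y
  · rw [hIR, hIR, hflux, ← intervalIntegral.integral_finsetSum]
    · simp only [Finset.sum_sub_distrib]
    · intro i _
      exact Continuous.intervalIntegrable (by fun_prop) _ _
  · have hH : HasDerivAt (fun t => Htil (fun i => u i (x, t)))
        (fderiv ℝ Htil (fun i => u i (x, y)) (fun i => pdy (u i) (x, y))) y :=
      (hHtil.differentiable one_ne_zero _).hasFDerivAt.comp_hasDerivAt y
        (hasDerivAt_pi.2 fun i => hasDerivAt_pdy (hu1 i) x y)
    have hsum := HasDerivAt.fun_sum (u := Finset.univ) fun i _ =>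
      (((hasDerivAt_pdy (hux i) x y).pow 2).sub
        (((hasDerivAt_pdy (huy i) x y).pow 2).const_mul ((f i x) ^ 2))).const_mul (1 / 2 : ℝ)
    refine (hsum.add hH).congr_deriv ?_
    rw [fderiv_apply_eq_sum_pdH, ← Finset.sum_add_distrib]
    refine Finset.sum_congr rfl fun i _ => ?_
    rw [← hHdef, ← hsys i (x, y), pdy_pdx_eq_pdx_pdy (hu i)]
    push_cast
    ring
end
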